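/- Every instance with three agents having additive nonnegative valuations over a finite set of items admits an (11/12)-MMS allocation: an allocation A = (A_1,A_2,A_3) with v^i(A_i) ≥ (11/12)·MMS^i for every agent i. -/

import Mathlib

/-- The total value of the bundle given to agent `j` by allocation/partition `f`. -/
noncomputable def bundleVal {M : Type*} [Fintype M] {n : ℕ} (v : M → ℝ)
    (f : M → Fin n) (j : Fin n) : ℝ :=
  ∑ e ∈ Finset.univ.filter (fun e => f e = j), v e

/-- The maximin share: max over partitions into `n` bundles of the min bundle value. -/
noncomputable def MMS {M : Type*} [Fintype M] [DecidableEq M] (n : ℕ) [NeZero n]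
    (v : M → ℝ) : ℝ :=
  Finset.univ.sup' Finset.univ_nonempty fun f : M → Fin n =>
    Finset.univ.inf' Finset.univ_nonempty fun j => bundleVal v f j

/-- The minimax share: min over partitions into `n` bundles of the max bundle value. -/
noncomputable def mmS {M : Type*} [Fintype M] [DecidableEq M] (n : ℕ) [NeZero n]
    (v : M → ℝ) : ℝ :=
  Finset.univ.inf' Finset.univ_nonempty fun f : M → Fin n =>
    Finset.univ.sup' Finset.univ_nonempty fun j => bundleVal v f j

/-- The proportional share: total value divided by the number `n` of agents. -/
noncomputable def PS {M : Type*} [Fintype M] (n : ℕ) (v : M → ℝ) : ℝ :=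
  (∑ e, v e) / n

/-- The value of the cells of a `3 × 3` grid that the assignment `f` gives to agent `k`. -/
noncomputable def gridShare (x : Fin 3 → Fin 3 → ℝ) (f : Fin 3 → Fin 3 → Fin 3) (k : Fin 3) : ℝ :=
  ∑ i, ∑ j, if f i j = k then x i j else 0

lemma gridShare_perm (x : Fin 3 → Fin 3 → ℝ) (f : Fin 3 → Fin 3 → Fin 3) (k : Fin 3)
    (σ τ : Equiv.Perm (Fin 3)) :
    gridShare x (fun i j => f (σ.symm i) (τ.symm j)) k =
      gridShare (fun i j => x (σ i) (τ j)) f k := by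
  unfold gridShare
  rw [← Equiv.sum_comp σ]
  refine Finset.sum_congr rfl fun i _ => ?_
  rw [← Equiv.sum_comp τ]
  simp

/-- Three nonnegative valuations of a `3 × 3` grid of items, normalized so that every row is worth
`12` under `a`, every column is worth `12` under `b`, and the grid is worth `36` under `c`, such
that no allocation gives `11` to the first two agents and `12` to the third. -/
structure NoGridAllocation (a b c : Fin 3 → Fin 3 → ℝ) : Prop where
  a_nonneg : ∀ i j, 0 ≤ a i j
  b_nonneg : ∀ i j, 0 ≤ b i j
  c_nonneg : ∀ i j, 0 ≤ c i j
  a_row : ∀ i, ∑ j, a i j = 12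
  b_col : ∀ j, ∑ i, b i j = 12
  c_total : ∑ i, ∑ j, c i j = 36
  no_alloc : ∀ f : Fin 3 → Fin 3 → Fin 3,
    ¬ (11 ≤ gridShare a f 0 ∧ 11 ≤ gridShare b f 1 ∧ 12 ≤ gridShare c f 2)

namespace NoGridAllocation

variable {a b c : Fin 3 → Fin 3 → ℝ}

lemma perm (h : NoGridAllocation a b c) (σ τ : Equiv.Perm (Fin 3)) :
    NoGridAllocation (fun i j => a (σ i) (τ j)) (fun i j => b (σ i) (τ j))
      (fun i j => c (σ i) (τ j)) where
  a_nonneg _ _ := h.a_nonneg _ _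
  b_nonneg _ _ := h.b_nonneg _ _
  c_nonneg _ _ := h.c_nonneg _ _
  a_row i := (Equiv.sum_comp τ (a (σ i))).trans (h.a_row _)
  b_col j := (Equiv.sum_comp σ fun i => b i (τ j)).trans (h.b_col _)
  c_total := (Finset.sum_congr rfl fun i _ => Equiv.sum_comp τ (c (σ i))).trans
    ((Equiv.sum_comp σ fun i => ∑ j, c i j).trans h.c_total)
  no_alloc f := by
    simpa only [gridShare_perm] using h.no_alloc fun i j => f (σ.symm i) (τ.symm j)

lemma transpose (h : NoGridAllocation a b c) :
    NoGridAllocation (fun i j => b j i) (fun i j => a j i) (fun i j => c j i) where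
  a_nonneg _ _ := h.b_nonneg _ _
  b_nonneg _ _ := h.a_nonneg _ _
  c_nonneg _ _ := h.c_nonneg _ _
  a_row := h.b_col
  b_col := h.a_row
  c_total := Finset.sum_comm.trans h.c_total
  no_alloc f := by
    have key (x : Fin 3 → Fin 3 → ℝ) (k : Fin 3) :
        gridShare x (fun i j => Equiv.swap 0 1 (f j i)) k =
          gridShare (fun i j => x j i) f (Equiv.swap 0 1 k) := by
      unfold gridShare
      rw [Finset.sum_comm]
      simp only [Equiv.swap_apply_eq_iff]
    rintro ⟨hb, ha, hc⟩
    refine h.no_alloc (fun i j => Equiv.swap 0 1 (f j i)) ⟨?_, ?_, ?_⟩ <;> rw [key] <;> simpa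

/-- The second agent accepts at most one row: otherwise the third agent takes the best row, the
second one an acceptable row that remains, and the first one the last row. -/
lemma row_lt_of_le_row (h : NoGridAllocation a b c) (h0 : 11 ≤ ∑ j, b 0 j) : ∑ j, b 1 j < 11 := by
  by_contra! h1
  have ha := h.a_row
  have hc := h.c_total
  simp only [Fin.sum_univ_three] at *
  have ha0 := ha 0
  have ha1 := ha 1
  have ha2 := ha 2
  have hc0 : c 0 0 + c 0 1 + c 0 2 < 12 := by
    by_contra! hlt
    refine h.no_alloc ![![2, 2, 2], ![1, 1, 1], ![0, 0, 0]] ⟨?_, ?_, ?_⟩ <;>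
      simp [gridShare, Fin.sum_univ_three] <;> linarith
  have hc1 : c 1 0 + c 1 1 + c 1 2 < 12 := by
    by_contra! hlt
    refine h.no_alloc ![![1, 1, 1], ![2, 2, 2], ![0, 0, 0]] ⟨?_, ?_, ?_⟩ <;>
      simp [gridShare, Fin.sum_univ_three] <;> linarith
  refine h.no_alloc ![![1, 1, 1], ![0, 0, 0], ![2, 2, 2]] ⟨?_, ?_, ?_⟩ <;>
    simp [gridShare, Fin.sum_univ_three] <;> linarith

lemma exists_perm_rows_lt (h : NoGridAllocation a b c) :
    ∃ σ : Equiv.Perm (Fin 3), ∑ j, b (σ 1) j < 11 ∧ ∑ j, b (σ 2) j < 11 := by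
  have h01 := h.row_lt_of_le_row
  have h02 := (h.perm (Equiv.swap 1 2) 1).row_lt_of_le_row
  have h12 := (h.perm (Equiv.swap 0 2) 1).row_lt_of_le_row
  rw [Equiv.swap_apply_of_ne_of_ne (by decide) (by decide)] at h02
  rw [Equiv.swap_apply_of_ne_of_ne (show (1 : Fin 3) ≠ 0 by decide) (by decide)] at h12
  simp only [Equiv.swap_apply_left, Equiv.Perm.one_apply] at h02 h12
  by_cases h0 : 11 ≤ ∑ j, b 0 j
  · exact ⟨1, h01 h0, h02 h0⟩
  by_cases h2 : 11 ≤ ∑ j, b 2 j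
  · refine ⟨Equiv.swap 0 2, ?_, ?_⟩
    · rw [Equiv.swap_apply_of_ne_of_ne (by decide) (by decide)]
      exact h12 h2
    · rw [Equiv.swap_apply_right]
      exact not_le.mp h0
  · refine ⟨Equiv.swap 0 1, ?_, ?_⟩
    · rw [Equiv.swap_apply_right]
      exact not_le.mp h0
    · rw [Equiv.swap_apply_of_ne_of_ne (by decide) (by decide)]
      exact not_le.mp h2

end NoGridAllocation

/-- A grid without a good allocation in which the second agent rejects rows `1` and `2` and the
first agent rejects columns `1` and `2`. -/
structure LightGrid (a b c : Fin 3 → Fin 3 → ℝ) : Prop extends NoGridAllocation a b c where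
  b_row_lt : ∀ i, i ≠ 0 → ∑ j, b i j < 11
  a_col_lt : ∀ j, j ≠ 0 → ∑ i, a i j < 11

namespace LightGrid

variable {a b c : Fin 3 → Fin 3 → ℝ}

lemma perm (h : LightGrid a b c) {σ τ : Equiv.Perm (Fin 3)} (hσ : σ 0 = 0) (hτ : τ 0 = 0) :
    LightGrid (fun i j => a (σ i) (τ j)) (fun i j => b (σ i) (τ j))
      (fun i j => c (σ i) (τ j)) where
  toNoGridAllocation := h.toNoGridAllocation.perm σ τ
  b_row_lt i hi := by
    rw [Equiv.sum_comp τ (b (σ i))]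
    exact h.b_row_lt _ fun h0 => hi (σ.injective (h0.trans hσ.symm))
  a_col_lt j hj := by
    rw [Equiv.sum_comp σ fun i => a i (τ j)]
    exact h.a_col_lt _ fun h0 => hj (τ.injective (h0.trans hτ.symm))

lemma transpose (h : LightGrid a b c) :
    LightGrid (fun i j => b j i) (fun i j => a j i) (fun i j => c j i) where
  toNoGridAllocation := h.toNoGridAllocation.transpose
  b_row_lt := h.a_col_lt
  a_col_lt := h.b_row_lt

lemma c_row_one_lt (h : LightGrid a b c) : c 1 0 + c 1 1 + c 1 2 < 12 := by
  have ha := h.a_row 2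
  have hb0 := h.b_col 0
  have hb1 := h.b_col 1
  have hb2 := h.b_col 2
  have hl1 := h.b_row_lt 1 (by decide)
  have hl2 := h.b_row_lt 2 (by decide)
  simp only [Fin.sum_univ_three] at *
  by_contra! hlt
  refine h.no_alloc ![![1, 1, 1], ![2, 2, 2], ![0, 0, 0]] ⟨?_, ?_, ?_⟩ <;>
    simp [gridShare, Fin.sum_univ_three] <;> linarith

lemma c_row_two_lt (h : LightGrid a b c) : c 2 0 + c 2 1 + c 2 2 < 12 :=
  (h.perm (σ := Equiv.swap 1 2) (τ := 1) (by decide) rfl).c_row_one_lt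

lemma c_col_one_lt (h : LightGrid a b c) : c 0 1 + c 1 1 + c 2 1 < 12 :=
  h.transpose.c_row_one_lt

lemma c_col_two_lt (h : LightGrid a b c) : c 0 2 + c 1 2 + c 2 2 < 12 :=
  h.transpose.c_row_two_lt

/-- The third agent does not accept both corners `{00, 01, 10}` and `{00, 02, 20}`. -/
lemma corner_lt_of_le_corner (h : LightGrid a b c) (hc : 12 ≤ c 0 0 + c 0 1 + c 1 0) :
    c 0 0 + c 0 2 + c 2 0 < 12 := by
  by_contra! hc'
  have ha1 := h.a_row 1
  have ha2 := h.a_row 2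
  have hb1 := h.b_col 1
  have hb2 := h.b_col 2
  simp only [Fin.sum_univ_three] at *
  have h1 : a 1 1 + a 2 0 + a 2 1 < 11 := by
    by_contra! hlt
    refine h.no_alloc ![![2, 2, 1], ![2, 0, 1], ![0, 0, 1]] ⟨?_, ?_, ?_⟩ <;>
      simp [gridShare, Fin.sum_univ_three] <;> linarith
  refine h.no_alloc ![![2, 1, 2], ![0, 1, 0], ![2, 1, 0]] ⟨?_, ?_, ?_⟩ <;>
    simp [gridShare, Fin.sum_univ_three] <;> linarith

/-- The third agent does not reject both corners `{00, 01, 10}` and `{00, 02, 20}`. -/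
lemma le_corner_of_corner_lt (h : LightGrid a b c) (hc : c 0 0 + c 0 1 + c 1 0 < 12) :
    12 ≤ c 0 0 + c 0 2 + c 2 0 := by
  by_contra! hc'
  have ha0 := h.a_row 0
  have ha1 := h.a_row 1
  have ha2 := h.a_row 2
  have hb1 := h.b_col 1
  have hb2 := h.b_col 2
  have hc1 := h.c_col_one_lt
  have hc2 := h.c_col_two_lt
  have htot := h.c_total
  have hl1 := h.a_col_lt 1 (by decide)
  have hl2 := h.a_col_lt 2 (by decide)
  simp only [Fin.sum_univ_three] at *
  have h1 : a 0 0 + a 0 1 + a 1 0 < 11 := by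
    by_contra! hlt
    refine h.no_alloc ![![0, 0, 1], ![0, 2, 1], ![2, 2, 1]] ⟨?_, ?_, ?_⟩ <;>
      simp [gridShare, Fin.sum_univ_three] <;> linarith
  refine h.no_alloc ![![0, 1, 0], ![2, 1, 2], ![0, 1, 2]] ⟨?_, ?_, ?_⟩ <;>
    simp [gridShare, Fin.sum_univ_three] <;> linarith

/-- If the third agent accepts the corner `{00, 01, 10}`, she accepts the corner `{00, 02, 10}`. -/
lemma le_corner_of_le_corner (h : LightGrid a b c) (hc : 12 ≤ c 0 0 + c 0 1 + c 1 0) :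
    12 ≤ c 0 0 + c 0 2 + c 1 0 := by
  by_contra! hc'
  have ha1 := h.a_row 1
  have ha2 := h.a_row 2
  have hb0 := h.b_col 0
  have hb1 := h.b_col 1
  have hb2 := h.b_col 2
  have htot := h.c_total
  have hr1 := h.c_row_one_lt
  have hr2 := h.c_row_two_lt
  have hc1 := h.c_col_one_lt
  have hbr1 := h.b_row_lt 1 (by decide)
  have hbr2 := h.b_row_lt 2 (by decide)
  have hac2 := h.a_col_lt 2 (by decide)
  have ha02 := h.a_nonneg 0 2
  have hc11 := h.c_nonneg 1 1
  have hc21 := h.c_nonneg 2 1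
  simp only [Fin.sum_univ_three] at *
  have a1 : a 1 1 + a 2 0 + a 2 1 < 11 := by
    by_contra! hlt
    refine h.no_alloc ![![2, 2, 1], ![2, 0, 1], ![0, 0, 1]] ⟨?_, ?_, ?_⟩ <;>
      simp [gridShare, Fin.sum_univ_three] <;> linarith
  have c1 : c 0 0 + c 0 2 + c 2 0 < 12 := by
    by_contra! hlt
    refine h.no_alloc ![![2, 1, 2], ![0, 1, 0], ![2, 1, 0]] ⟨?_, ?_, ?_⟩ <;>
      simp [gridShare, Fin.sum_univ_three] <;> linarith
  have b1 : b 0 0 + b 0 2 + b 2 0 < 11 := by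
    by_contra! hlt
    refine h.no_alloc ![![1, 2, 1], ![0, 0, 0], ![1, 2, 2]] ⟨?_, ?_, ?_⟩ <;>
      simp [gridShare, Fin.sum_univ_three] <;> linarith
  have b2 : b 0 0 + b 0 2 + b 1 0 < 11 := by
    by_contra! hlt
    refine h.no_alloc ![![1, 2, 1], ![1, 2, 2], ![0, 0, 0]] ⟨?_, ?_, ?_⟩ <;>
      simp [gridShare, Fin.sum_univ_three] <;> linarith
  have b3 : b 0 1 + b 1 1 < 11 := by
    by_contra! hlt
    refine h.no_alloc ![![2, 1, 2], ![2, 1, 2], ![0, 0, 0]] ⟨?_, ?_, ?_⟩ <;>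
      simp [gridShare, Fin.sum_univ_three] <;> linarith
  have b4 : b 0 1 + b 2 1 < 11 := by
    by_contra! hlt
    refine h.no_alloc ![![2, 1, 2], ![0, 0, 0], ![2, 1, 2]] ⟨?_, ?_, ?_⟩ <;>
      simp [gridShare, Fin.sum_univ_three] <;> linarith
  have c2 : c 0 0 + c 0 1 < 12 := by
    by_contra! hlt
    refine h.no_alloc ![![2, 2, 1], ![0, 0, 1], ![0, 0, 1]] ⟨?_, ?_, ?_⟩ <;>
      simp [gridShare, Fin.sum_univ_three] <;> linarith
  have b5 : b 0 0 + b 0 1 < 11 := by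
    by_contra! hlt
    refine h.no_alloc ![![1, 1, 2], ![0, 0, 0], ![2, 2, 2]] ⟨?_, ?_, ?_⟩ <;>
      simp [gridShare, Fin.sum_univ_three] <;> linarith
  have c3 : c 0 0 + c 1 0 + c 1 2 < 12 := by
    by_contra! hlt
    refine h.no_alloc ![![2, 1, 1], ![2, 1, 2], ![0, 0, 0]] ⟨?_, ?_, ?_⟩ <;>
      simp [gridShare, Fin.sum_univ_three] <;> linarith
  have b6 : b 0 0 + b 0 1 + b 2 1 < 11 := by
    by_contra! hlt
    refine h.no_alloc ![![1, 1, 2], ![0, 0, 0], ![2, 1, 2]] ⟨?_, ?_, ?_⟩ <;>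
      simp [gridShare, Fin.sum_univ_three] <;> linarith
  have c4 : c 0 2 + c 1 0 + c 1 1 < 12 := by
    by_contra! hlt
    refine h.no_alloc ![![1, 1, 2], ![2, 2, 1], ![0, 0, 0]] ⟨?_, ?_, ?_⟩ <;>
      simp [gridShare, Fin.sum_univ_three] <;> linarith
  have b7 : b 0 2 + b 1 0 + b 1 1 < 11 := by
    by_contra! hlt
    refine h.no_alloc ![![2, 2, 1], ![1, 1, 2], ![0, 0, 0]] ⟨?_, ?_, ?_⟩ <;>
      simp [gridShare, Fin.sum_univ_three] <;> linarith
  have c5 : c 0 2 + c 2 0 + c 2 1 < 12 := by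
    by_contra! hlt
    refine h.no_alloc ![![1, 1, 2], ![0, 0, 0], ![2, 2, 1]] ⟨?_, ?_, ?_⟩ <;>
      simp [gridShare, Fin.sum_univ_three] <;> linarith
  have b8 : b 0 2 + b 2 0 + b 2 1 < 11 := by
    by_contra! hlt
    refine h.no_alloc ![![2, 2, 1], ![0, 0, 0], ![1, 1, 2]] ⟨?_, ?_, ?_⟩ <;>
      simp [gridShare, Fin.sum_univ_three] <;> linarith
  linarith

end LightGrid

theorem not_lightGrid (a b c : Fin 3 → Fin 3 → ℝ) : ¬ LightGrid a b c := by
  intro h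
  have hs : (Equiv.swap 1 2 : Equiv.Perm (Fin 3)) 0 = 0 := by decide
  have h11 : 12 ≤ c 0 0 + c 0 1 + c 1 0 → 12 ≤ c 0 0 + c 0 2 + c 1 0 := h.le_corner_of_le_corner
  have h12 : 12 ≤ c 0 0 + c 0 2 + c 1 0 → 12 ≤ c 0 0 + c 0 1 + c 1 0 :=
    (h.perm (σ := 1) rfl hs).le_corner_of_le_corner
  have h12' : 12 ≤ c 0 0 + c 1 0 + c 0 2 → 12 ≤ c 0 0 + c 2 0 + c 0 2 :=
    (h.transpose.perm (τ := 1) hs rfl).le_corner_of_le_corner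
  have h22 : 12 ≤ c 0 0 + c 2 0 + c 0 2 → 12 ≤ c 0 0 + c 1 0 + c 0 2 :=
    (h.transpose.perm hs hs).le_corner_of_le_corner
  by_cases hc : 12 ≤ c 0 0 + c 0 1 + c 1 0
  · have := h.corner_lt_of_le_corner hc
    have := h12' (by linarith [h11 hc])
    linarith
  · have := h.le_corner_of_corner_lt (not_le.mp hc)
    exact hc (h12 (by linarith [h22 (by linarith)]))

theorem exists_grid_allocation {a b c : Fin 3 → Fin 3 → ℝ} (ha : ∀ i j, 0 ≤ a i j)
    (hb : ∀ i j, 0 ≤ b i j) (hc : ∀ i j, 0 ≤ c i j) (ha_row : ∀ i, ∑ j, a i j = 12)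
    (hb_col : ∀ j, ∑ i, b i j = 12) (hc_total : ∑ i, ∑ j, c i j = 36) :
    ∃ f : Fin 3 → Fin 3 → Fin 3,
      11 ≤ gridShare a f 0 ∧ 11 ≤ gridShare b f 1 ∧ 12 ≤ gridShare c f 2 := by
  by_contra! H
  have h : NoGridAllocation a b c :=
    ⟨ha, hb, hc, ha_row, hb_col, hc_total, fun f hf => (H f hf.1 hf.2.1).not_ge hf.2.2⟩
  obtain ⟨σ, hσ1, hσ2⟩ := h.exists_perm_rows_lt
  obtain ⟨τ, hτ1, hτ2⟩ := h.transpose.exists_perm_rows_lt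
  refine not_lightGrid _ _ _ ⟨h.perm σ τ, fun i hi => ?_, fun j hj => ?_⟩
  · rw [Equiv.sum_comp τ (b (σ i))]
    fin_cases i
    exacts [absurd rfl hi, hσ1, hσ2]
  · rw [Equiv.sum_comp σ fun i => a i (τ j)]
    fin_cases j
    exacts [absurd rfl hj, hτ1, hτ2]

lemma exists_normalization {ι : Type*} [Fintype ι] [Nonempty ι] {V : ι → ℝ} (hV : ∀ i, 0 ≤ V i)
    {K T : ℝ} (hT : 0 ≤ T) (hK : K ≤ ∑ i, V i) :
    ∃ a : ι → ℝ, (∀ i, 0 ≤ a i) ∧ ∑ i, a i = T ∧ ∀ i, K * a i ≤ T * V i := by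
  rcases (Finset.sum_nonneg fun i (_ : i ∈ Finset.univ) => hV i).eq_or_lt with h0 | hpos
  · refine ⟨fun _ => T / Fintype.card ι, fun _ => by positivity, ?_, fun i => ?_⟩
    · simp [Finset.card_univ]
      field_simp
    · exact (mul_nonpos_of_nonpos_of_nonneg (hK.trans h0.ge) (by positivity)).trans
        (mul_nonneg hT (hV i))
  · refine ⟨fun i => T * V i / ∑ i, V i, fun i => ?_, ?_, fun i => ?_⟩
    · exact div_nonneg (mul_nonneg hT (hV i)) hpos.le
    · rw [← Finset.sum_div, ← Finset.mul_sum, mul_div_cancel_right₀ _ hpos.ne']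
    · rw [← mul_div_assoc, div_le_iff₀ hpos, mul_comm]
      exact mul_le_mul_of_nonneg_left hK (mul_nonneg hT (hV i))

section Items

variable {M : Type*} [Fintype M]

/-- The value of the items in each cell of the grid formed by two partitions. -/
noncomputable def cellVal (v : M → ℝ) (p q : M → Fin 3) (i j : Fin 3) : ℝ :=
  ∑ e, if p e = i ∧ q e = j then v e else 0

lemma cellVal_nonneg {v : M → ℝ} (hv : ∀ e, 0 ≤ v e) (p q : M → Fin 3) (i j : Fin 3) :
    0 ≤ cellVal v p q i j :=
  Finset.sum_nonneg fun e _ => by split_ifs <;> simp [hv]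

lemma bundleVal_eq_gridShare (v : M → ℝ) (p q : M → Fin 3) (f : Fin 3 → Fin 3 → Fin 3)
    (k : Fin 3) : bundleVal v (fun e => f (p e) (q e)) k = gridShare (cellVal v p q) f k := by
  have key (i j : Fin 3) : (if f i j = k then cellVal v p q i j else 0) =
      ∑ e, if p e = i then if q e = j then if f (p e) (q e) = k then v e else 0 else 0 else 0 := by
    rw [cellVal, Finset.ite_sum_zero]
    refine Finset.sum_congr rfl fun e _ => ?_
    split_ifs <;> simp_all
  simp only [bundleVal, gridShare, key, Finset.sum_filter]
  simp_rw [Finset.sum_comm (s := (Finset.univ : Finset (Fin 3))) (t := (Finset.univ : Finset M))]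
  simp [Finset.sum_ite_irrel]

lemma sum_bundleVal (v : M → ℝ) {n : ℕ} (p : M → Fin n) : ∑ i, bundleVal v p i = ∑ e, v e :=
  Finset.sum_fiberwise Finset.univ p v

lemma sum_cellVal_row (v : M → ℝ) (p q : M → Fin 3) (i : Fin 3) :
    ∑ j, cellVal v p q i j = bundleVal v p i := by
  simp only [cellVal, bundleVal, Finset.sum_filter]
  rw [Finset.sum_comm]
  simp [ite_and, Finset.sum_ite_irrel]

lemma sum_cellVal_col (v : M → ℝ) (p q : M → Fin 3) (j : Fin 3) :
    ∑ i, cellVal v p q i j = bundleVal v q j := by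
  simp only [cellVal, bundleVal, Finset.sum_filter]
  rw [Finset.sum_comm]
  simp [ite_and]

lemma bundleVal_nonneg {v : M → ℝ} (hv : ∀ e, 0 ≤ v e) {n : ℕ} (p : M → Fin n) (i : Fin n) :
    0 ≤ bundleVal v p i :=
  Finset.sum_nonneg fun e _ => hv e

lemma exists_MMS_le_bundleVal [DecidableEq M] (v : M → ℝ) :
    ∃ p : M → Fin 3, ∀ i, MMS 3 v ≤ bundleVal v p i := by
  obtain ⟨p, -, hp⟩ := Finset.exists_mem_eq_sup' Finset.univ_nonempty
    fun f : M → Fin 3 => Finset.univ.inf' Finset.univ_nonempty fun j => bundleVal v f j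
  exact ⟨p, fun i => hp.le.trans (Finset.inf'_le _ (Finset.mem_univ i))⟩

/-- Scale a bound on normalized cell values back to the original valuation. -/
lemma mul_MMS_le_bundleVal [DecidableEq M] {v : M → ℝ} (hv : ∀ e, 0 ≤ v e) {p q : M → Fin 3}
    {x : Fin 3 → Fin 3 → ℝ} (hx : ∀ i j, MMS 3 v * x i j ≤ 12 * cellVal v p q i j)
    {f : Fin 3 → Fin 3 → Fin 3} {k : Fin 3} (hf : 11 ≤ gridShare x f k) :
    (11/12 : ℝ) * MMS 3 v ≤ bundleVal v (fun e => f (p e) (q e)) k := by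
  rcases le_total (MMS 3 v) 0 with hm | hm
  · have := bundleVal_nonneg hv (fun e => f (p e) (q e)) k
    linarith
  · have h : MMS 3 v * gridShare x f k ≤ 12 * gridShare (cellVal v p q) f k := by
      simp only [gridShare, Finset.mul_sum]
      refine Finset.sum_le_sum fun i _ => Finset.sum_le_sum fun j _ => ?_
      split_ifs
      · exact hx i j
      · simp
    rw [bundleVal_eq_gridShare]
    linarith [mul_le_mul_of_nonneg_left hf hm]

end Items

/-- Every instance with three agents with additive nonnegative valuations
admits an (11/12)-MMS allocation. -/
theorem exists_eleven_twelfths_MMS_allocation {M : Type*} [Fintype M] [DecidableEq M]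
    (v : Fin 3 → M → ℝ) (hv : ∀ i e, 0 ≤ v i e) :
    ∃ A : M → Fin 3, ∀ i, (11/12 : ℝ) * MMS 3 (v i) ≤ bundleVal (v i) A i := by
  obtain ⟨p, hp⟩ := exists_MMS_le_bundleVal (v 0)
  obtain ⟨q, hq⟩ := exists_MMS_le_bundleVal (v 1)
  obtain ⟨r, hr⟩ := exists_MMS_le_bundleVal (v 2)
  choose a ha ha_row hav using fun i => exists_normalization
    (fun j => cellVal_nonneg (hv 0) p q i j) (T := 12) (by norm_num)
    ((hp i).trans (sum_cellVal_row (v 0) p q i).ge)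
  choose b hb hb_col hbv using fun j => exists_normalization
    (fun i => cellVal_nonneg (hv 1) p q i j) (T := 12) (by norm_num)
    ((hq j).trans (sum_cellVal_col (v 1) p q j).ge)
  have hK : 3 * MMS 3 (v 2) ≤ ∑ x : Fin 3 × Fin 3, cellVal (v 2) p q x.1 x.2 := by
    rw [Fintype.sum_prod_type]
    simp only [sum_cellVal_row]
    rw [sum_bundleVal, ← sum_bundleVal (v 2) r, Fin.sum_univ_three]
    linarith [hr 0, hr 1, hr 2]
  obtain ⟨c, hc, hc_total, hcv⟩ := exists_normalization
    (fun x : Fin 3 × Fin 3 => cellVal_nonneg (hv 2) p q x.1 x.2) (T := 36) (by norm_num) hK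
  rw [Fintype.sum_prod_type] at hc_total
  obtain ⟨f, h0, h1, h2⟩ := exists_grid_allocation ha (fun i j => hb j i) (fun i j => hc (i, j))
    ha_row hb_col hc_total
  refine ⟨fun e => f (p e) (q e), fun k => ?_⟩
  fin_cases k
  · exact mul_MMS_le_bundleVal (hv 0) hav h0
  · exact mul_MMS_le_bundleVal (hv 1) (fun i j => hbv j i) h1
  · exact mul_MMS_le_bundleVal (hv 2) (fun i j => by linarith [hcv (i, j)])
      (le_trans (by norm_num) h2)
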